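/- arXiv:2503.16673 — 2 statements merged into one kernel-verified Lean document; each statement's English description precedes it below -/
import Mathlib

section
/- Let f : ℝ^{n×n} → ℝ be convex, let Ā, A ∈ ℝ^{n×n} with A ≠ Ā, and let G ≠ 0 be a subgradient of f at A. Suppose there are constants c > 0 and M > 0 with f(A) − f(Ā) ≥ c · ‖A − Ā‖_F and ‖G‖_F ≤ M. Define the Polyak step size β = (f(A) − f(Ā)) / ‖G‖_F². Then c ≤ M and ‖(A − βG) − Ā‖_F ≤ √(1 − c²/M²) · ‖A − Ā‖_F. -/
open Matrix

/-- The Frobenius inner product `⟨X, Y⟩ = tr(Xᵀ Y)` on `ℝ^{n×n}`. -/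
noncomputable def finner {n : ℕ} (X Y : Matrix (Fin n) (Fin n) ℝ) : ℝ :=
  (Xᵀ * Y).trace

/-- The Frobenius norm on `ℝ^{n×n}`. -/
noncomputable def fnorm {n : ℕ} (X : Matrix (Fin n) (Fin n) ℝ) : ℝ :=
  Real.sqrt (finner X X)

/-- `G` is a subgradient of `f : ℝ^{n×n} → ℝ` at `A` if
`f(B) ≥ f(A) + ⟨G, B − A⟩` for all `B`, with the Frobenius inner product. -/
def IsMatSubgradientAt {n : ℕ} (f : Matrix (Fin n) (Fin n) ℝ → ℝ)
    (G A : Matrix (Fin n) (Fin n) ℝ) : Prop :=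
  ∀ B, f B ≥ f A + finner G (B - A)

theorem finner_comm {n : ℕ} (X Y : Matrix (Fin n) (Fin n) ℝ) : finner X Y = finner Y X := by
  unfold finner
  rw [← trace_transpose, transpose_mul, transpose_transpose]

theorem finner_self_nonneg {n : ℕ} (X : Matrix (Fin n) (Fin n) ℝ) : 0 ≤ finner X X := by
  simp only [finner, trace, diag_apply, mul_apply, transpose_apply]
  exact Finset.sum_nonneg fun i _ => Finset.sum_nonneg fun j _ => mul_self_nonneg _

theorem finner_self_pos {n : ℕ} {X : Matrix (Fin n) (Fin n) ℝ} (hX : X ≠ 0) :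
    0 < finner X X := by
  refine (finner_self_nonneg X).lt_of_ne' fun h => hX ?_
  rw [finner, ← conjTranspose_eq_transpose_of_trivial] at h
  exact trace_conjTranspose_mul_self_eq_zero_iff.mp h

theorem fnorm_sq {n : ℕ} (X : Matrix (Fin n) (Fin n) ℝ) : fnorm X ^ 2 = finner X X :=
  Real.sq_sqrt (finner_self_nonneg X)

theorem fnorm_pos {n : ℕ} {X : Matrix (Fin n) (Fin n) ℝ} (hX : X ≠ 0) : 0 < fnorm X :=
  Real.sqrt_pos.mpr (finner_self_pos hX)

theorem finner_neg_right {n : ℕ} (X Y : Matrix (Fin n) (Fin n) ℝ) :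
    finner X (-Y) = -finner X Y := by
  simp [finner]

theorem fnorm_sub_smul_sq {n : ℕ} (X Y : Matrix (Fin n) (Fin n) ℝ) (t : ℝ) :
    fnorm (X - t • Y) ^ 2 = fnorm X ^ 2 - 2 * t * finner Y X + t ^ 2 * fnorm Y ^ 2 := by
  have h : finner (X - t • Y) (X - t • Y)
      = finner X X - t * finner X Y - t * finner Y X + t ^ 2 * finner Y Y := by
    simp only [finner, transpose_sub, transpose_smul, Matrix.sub_mul, Matrix.mul_sub,
      Matrix.smul_mul, Matrix.mul_smul, trace_sub, trace_smul, smul_eq_mul]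
    ring
  rw [fnorm_sq, fnorm_sq, fnorm_sq, h, finner_comm X Y]
  ring

/-- Deterministic contraction step behind Theorem 3 of the paper: under
sharpness (`f(A) − f(Ā) ≥ c‖A − Ā‖_F`) and a subgradient-norm bound
(`‖G‖_F ≤ M`), the Polyak step `β = (f(A) − f(Ā))/‖G‖_F²` achieves the linear
rate `√(1 − c²/M²)`; moreover `c ≤ M`. -/
theorem polyak_step_contraction {n : ℕ} (hn : 1 ≤ n)
    (f : Matrix (Fin n) (Fin n) ℝ → ℝ) (hconv : ConvexOn ℝ Set.univ f)
    (Abar A G : Matrix (Fin n) (Fin n) ℝ) (hA : A ≠ Abar) (hG : G ≠ 0)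
    (hsub : IsMatSubgradientAt f G A)
    (c M : ℝ) (hc : 0 < c) (hM : 0 < M)
    (hsharp : f A - f Abar ≥ c * fnorm (A - Abar))
    (hGnorm : fnorm G ≤ M) :
    c ≤ M ∧
      fnorm ((A - ((f A - f Abar) / fnorm G ^ 2) • G) - Abar)
        ≤ Real.sqrt (1 - c ^ 2 / M ^ 2) * fnorm (A - Abar) := by
  have hd : 0 < fnorm (A - Abar) := fnorm_pos (sub_ne_zero.mpr hA)
  have hg : 0 < fnorm G := fnorm_pos hG
  have hinner : f A - f Abar ≤ finner G (A - Abar) := by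
    have h := hsub Abar
    rw [← neg_sub A Abar, finner_neg_right] at h
    linarith
  rw [sub_right_comm]
  set d := fnorm (A - Abar)
  set g := fnorm G
  set δ := f A - f Abar
  have hδ : 0 ≤ δ := (mul_pos hc hd).le.trans hsharp
  have hstep : fnorm (A - Abar - (δ / g ^ 2) • G) ^ 2 ≤ d ^ 2 - (δ / g) ^ 2 := by
    rw [fnorm_sub_smul_sq]
    have h1 : δ / g ^ 2 * δ ≤ δ / g ^ 2 * finner G (A - Abar) := by gcongr
    have h2 : δ / g ^ 2 * δ = (δ / g) ^ 2 := by ring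
    have h3 : (δ / g ^ 2) ^ 2 * g ^ 2 = (δ / g) ^ 2 := by field_simp
    change d ^ 2 - _ + (δ / g ^ 2) ^ 2 * g ^ 2 ≤ _
    linarith
  have hratio : c * d / M ≤ δ / g := div_le_div₀ hδ hsharp hg hGnorm
  have hcontr : fnorm (A - Abar - (δ / g ^ 2) • G) ^ 2 ≤ (1 - c ^ 2 / M ^ 2) * d ^ 2 := by
    have h1 : (c * d / M) ^ 2 ≤ (δ / g) ^ 2 := by gcongr
    have h2 : (1 - c ^ 2 / M ^ 2) * d ^ 2 = d ^ 2 - (c * d / M) ^ 2 := by ring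
    linarith
  have hrate : 0 ≤ 1 - c ^ 2 / M ^ 2 :=
    nonneg_of_mul_nonneg_left ((sq_nonneg _).trans hcontr) (by positivity)
  constructor
  · have h : c ^ 2 ≤ M ^ 2 := (div_le_one (by positivity)).mp (sub_nonneg.mp hrate)
    exact (sq_le_sq₀ hc.le hM.le).mp h
  · refine (sq_le_sq₀ (Real.sqrt_nonneg _) (by positivity)).mp ?_
    rwa [mul_pow, Real.sq_sqrt hrate]
end

section
/- Let Ā ∈ ℝ^{n×n}, integers T₀ ≤ T̄, and for each T ∈ {T₀, …, T̄} let f_T : ℝ^{n×n} → ℝ be convex, let β^{(T)} ≥ 0, and let G_T be a subgradient of f_T at A^{(T)}, where the iterates satisfy A^{(T+1)} = A^{(T)} − β^{(T)} G_T. Suppose there are constants M > 0 and c > 0 such that for every T ∈ {T₀, …, T̄}: ‖G_T‖_F ≤ M·T and f_T(A^{(T)}) − f_T(Ā) ≥ c·T·‖A^{(T)} − Ā‖_F. Set D = ‖A^{(T₀)} − Ā‖_F and assume ∑_{T=T₀}^{T̄} β^{(T)} T > 0. Then min_{T ∈ {T₀,…,T̄}} ‖A^{(T)} − Ā‖_F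 ≤ ( D² + M² ∑_{T=T₀}^{T̄} (β^{(T)} T)² ) / ( 2 c ∑_{T=T₀}^{T̄} β^{(T)} T ). -/
open Matrix

theorem fnorm_sub_smul_sub_sq {n : ℕ} (A G B : Matrix (Fin n) (Fin n) ℝ) (b : ℝ) :
    fnorm (A - b • G - B) ^ 2 =
      fnorm (A - B) ^ 2 + 2 * b * finner G (B - A) + b ^ 2 * fnorm G ^ 2 := by
  have h := finner_comm G (B - A)
  simp only [fnorm_sq]
  simp only [finner, Matrix.transpose_sub, Matrix.transpose_smul, Matrix.sub_mul, Matrix.mul_sub,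
    Matrix.smul_mul, Matrix.mul_smul, Matrix.trace_sub, Matrix.trace_smul, smul_eq_mul] at h ⊢
  linear_combination -b * h

/-- One subgradient step under sharpness decreases the squared distance to the sharp point, up to
the squared step length. -/
theorem fnorm_subgradient_step_sq_le {n : ℕ} {f : Matrix (Fin n) (Fin n) ℝ → ℝ}
    {A G B : Matrix (Fin n) (Fin n) ℝ} {b s r : ℝ} (hb : 0 ≤ b)
    (hsub : IsMatSubgradientAt f G A) (hG : fnorm G ≤ r)
    (hsharp : s * fnorm (A - B) ≤ f A - f B) :
    fnorm (A - b • G - B) ^ 2 ≤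
      fnorm (A - B) ^ 2 - 2 * (b * s) * fnorm (A - B) + (b * r) ^ 2 := by
  have h₁ : b * finner G (B - A) ≤ b * -(s * fnorm (A - B)) :=
    mul_le_mul_of_nonneg_left (by linarith [hsub B]) hb
  have h₂ : b ^ 2 * fnorm G ^ 2 ≤ b ^ 2 * r ^ 2 :=
    mul_le_mul_of_nonneg_left (pow_le_pow_left₀ (Real.sqrt_nonneg _) hG 2) (sq_nonneg b)
  rw [fnorm_sub_smul_sub_sq]
  linarith

/-- Deterministic content of Lemma 5 of the paper: under per-period convexity,
subgradient updates `A^{(T+1)} = A^{(T)} − β^{(T)} G_T` with `β^{(T)} ≥ 0`,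
subgradient-norm bounds `‖G_T‖_F ≤ M·T` and sharpness
`f_T(A^{(T)}) − f_T(Ā) ≥ c·T·‖A^{(T)} − Ā‖_F`, the minimum solution gap over
the window `[T₀, T̄]` is at most
`(D² + M² ∑ (β^{(T)} T)²) / (2c ∑ β^{(T)} T)` where `D = ‖A^{(T₀)} − Ā‖_F`. -/
theorem min_solution_gap_bound {n : ℕ} (hn : 1 ≤ n)
    (Abar : Matrix (Fin n) (Fin n) ℝ) (T₀ Tbar : ℕ) (hT : T₀ ≤ Tbar)
    (f : ℕ → Matrix (Fin n) (Fin n) ℝ → ℝ)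
    (hconv : ∀ T ∈ Finset.Icc T₀ Tbar, ConvexOn ℝ Set.univ (f T))
    (β : ℕ → ℝ) (hβ : ∀ T ∈ Finset.Icc T₀ Tbar, 0 ≤ β T)
    (A G : ℕ → Matrix (Fin n) (Fin n) ℝ)
    (hiter : ∀ T ∈ Finset.Icc T₀ Tbar, A (T + 1) = A T - β T • G T)
    (hsub : ∀ T ∈ Finset.Icc T₀ Tbar, IsMatSubgradientAt (f T) (G T) (A T))
    (M c : ℝ) (hM : 0 < M) (hc : 0 < c)
    (hGnorm : ∀ T ∈ Finset.Icc T₀ Tbar, fnorm (G T) ≤ M * (T : ℝ))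
    (hsharp : ∀ T ∈ Finset.Icc T₀ Tbar,
      f T (A T) - f T Abar ≥ c * (T : ℝ) * fnorm (A T - Abar))
    (hpos : 0 < ∑ T ∈ Finset.Icc T₀ Tbar, β T * (T : ℝ)) :
    (Finset.Icc T₀ Tbar).inf' (Finset.nonempty_Icc.mpr hT)
        (fun T => fnorm (A T - Abar))
      ≤ (fnorm (A T₀ - Abar) ^ 2
            + M ^ 2 * ∑ T ∈ Finset.Icc T₀ Tbar, (β T * (T : ℝ)) ^ 2)
          / (2 * c * ∑ T ∈ Finset.Icc T₀ Tbar, β T * (T : ℝ)) := by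
  set m := (Finset.Icc T₀ Tbar).inf' (Finset.nonempty_Icc.mpr hT) fun T => fnorm (A T - Abar)
  have step : ∀ T ∈ Finset.Icc T₀ Tbar,
      2 * c * m * (β T * T) - M ^ 2 * (β T * T) ^ 2 ≤
        fnorm (A T - Abar) ^ 2 - fnorm (A (T + 1) - Abar) ^ 2 := by
    intro T hmem
    have hdec := fnorm_subgradient_step_sq_le (hβ T hmem) (hsub T hmem) (hGnorm T hmem)
      (hsharp T hmem)
    rw [← hiter T hmem] at hdec
    have hmin : m ≤ fnorm (A T - Abar) := Finset.inf'_le _ hmem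
    have hcoef : 0 ≤ 2 * c * (β T * T) := by
      have := hβ T hmem
      positivity
    linarith [mul_le_mul_of_nonneg_left hmin hcoef]
  have htel : ∑ T ∈ Finset.Icc T₀ Tbar,
      (fnorm (A T - Abar) ^ 2 - fnorm (A (T + 1) - Abar) ^ 2) =
        fnorm (A T₀ - Abar) ^ 2 - fnorm (A (Tbar + 1) - Abar) ^ 2 := by
    rw [← neg_inj, ← Finset.sum_neg_distrib]
    simp only [neg_sub]
    exact Finset.sum_Icc_sub hT fun T => fnorm (A T - Abar) ^ 2
  have hsum := Finset.sum_le_sum step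
  rw [htel, Finset.sum_sub_distrib, ← Finset.mul_sum, ← Finset.mul_sum] at hsum
  rw [le_div_iff₀ (by positivity)]
  linarith [sq_nonneg (fnorm (A (Tbar + 1) - Abar))]
end
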